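/- arXiv:1307.3791 — 2 statements merged into one kernel-verified Lean document; each statement's English description precedes it below -/
import Mathlib

section
/- Under the attempt model with reciprocal channels, i.e. with feedback erasure probability q equal to the data erasure probability p, where 0 < p ≤ 1: the conditional probability that the packet was never received in θ ≥ 1 attempts, given that the sender heard no feedback in any attempt, equals (1/(2−p))^θ. -/
open MeasureTheory ProbabilityTheory

/-- Conditioning a finite power of a measure on a cube yields the power of the conditional
probability of one factor. -/
theorem cond_pi_forall_mem {ι α : Type*} [Fintype ι] [MeasurableSpace α]
    (μ : Measure α) [SigmaFinite μ] {s : Set α} (hs : MeasurableSet s) (t : Set α) :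
    (Measure.pi fun _ : ι => μ)[|{ω | ∀ i, ω i ∈ s}] {ω | ∀ i, ω i ∈ t}
      = μ[|s] t ^ Fintype.card ι := by
  have hcube (u : Set α) : {ω : ι → α | ∀ i, ω i ∈ u} = Set.univ.pi fun _ => u := by
    ext ω
    simp
  rw [hcube, hcube, cond_apply (MeasurableSet.univ_pi fun _ => hs), ← Set.pi_inter_distrib,
    Measure.pi_pi, Measure.pi_pi, cond_apply hs]
  simp [mul_pow, ENNReal.inv_pow]

/-- Reciprocal channels: the feedback erasure probability equals the
data erasure probability `p ∈ (0,1]`.  Each of `θ ≥ 1` independent attempts results in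
forward-link erasure (outcome `0`, probability `p`), reception with feedback erasure
(outcome `1`, probability `(1-p)p`), or reception with heard feedback (outcome `2`,
probability `(1-p)(1-p)`).  The conditional probability that the packet was never
received, given that no feedback was heard in any attempt, is `(1/(2-p))^θ`. -/
theorem stmt1 (p : ℝ) (hp0 : 0 < p) (hp1 : p ≤ 1)
    (θ : ℕ) (hθ : 1 ≤ θ)
    (μ : Measure (Fin 3))
    (hμ : μ = (ENNReal.ofReal p) • Measure.dirac 0
        + (ENNReal.ofReal ((1 - p) * p)) • Measure.dirac 1
        + (ENNReal.ofReal ((1 - p) * (1 - p))) • Measure.dirac 2)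
    (P : Measure (Fin θ → Fin 3)) (hP : P = Measure.pi fun _ => μ) :
    P[|{ω | ∀ i, ω i ≠ 2}] {ω | ∀ i, ω i = 0}
      = ENNReal.ofReal ((1 / (2 - p)) ^ θ) := by
  have hp2 : 0 < 2 - p := by linarith
  have hfin : IsFiniteMeasure μ := by
    rw [hμ]
    exact ⟨by simp⟩
  have hnever : μ ({2}ᶜ ∩ {0}) = ENNReal.ofReal p := by
    simp [hμ]
  have hunheard : μ {2}ᶜ = ENNReal.ofReal (p * (2 - p)) := by
    rw [show p * (2 - p) = p + (1 - p) * p by ring,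
      ENNReal.ofReal_add hp0.le (mul_nonneg (sub_nonneg.2 hp1) hp0.le)]
    simp [hμ]
  have hcond : μ[|{2}ᶜ] {0} = ENNReal.ofReal (1 / (2 - p)) := by
    rw [cond_apply (by measurability), hnever, hunheard,
      ← ENNReal.ofReal_inv_of_pos (by positivity), ← ENNReal.ofReal_mul (by positivity)]
    congr 1
    field_simp
  have hpow := cond_pi_forall_mem (ι := Fin θ) μ (s := {2}ᶜ) (by measurability) {0}
  rw [hcond, Fintype.card_fin, ← ENNReal.ofReal_pow (by positivity)] at hpow
  rw [hP]
  exact hpow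
end

section
/- Let O be a finite set of receivers, let τ_n, τ_u ⊆ O be disjoint subsets, let ν = O ∖ (τ_n ∪ τ_u), and let F ⊆ O with F ∩ τ_n = ∅. For each i ∈ O let p_i ∈ ℝ, let W_i be a finite set, let r_{i,h} ∈ ℝ for h ∈ W_i, and for i ∈ τ_u let j_i ∈ W_i. Define the expected decoding delay E = ∑_{i∈ν} (1−p_i) + ∑_{i∈τ_u} (1−p_i)·r_{i,j_i} − ∑_{i∈F} (1−p_i)·∏_{h∈W_i} r_{i,h}, and the clique weight W = ∑_{i∈τ_n} (1−p_i) + ∑_{i∈τ_u} (1−p_i)(1 − r_{i,j_i}). Then E + W = ∑_{i∈O} (1−p_i) − ∑_{i∈F} (1−p_i)·∏_{h∈W_i} r_{i,h}, a quantity independent of the choice of (τ_n, τ_u); consequently, among all admissible choices of disjoint (τ_n, τ_u), a choice minimizes E if and only if it maximizes W. -/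
/-- With `E c` the expected sum decoding delay increment and `Wt c`
the total clique weight of an admissible choice `c = (τn, τu)` of disjoint sets of
targeted receivers, `E c + Wt c = ∑_{i∈O} (1-p i) - ∑_{i∈F} (1-p i)·∏_{h∈W i} r i h`
is independent of `c`; consequently, an admissible choice minimizes `E` iff it
maximizes `Wt`. -/
theorem stmt11 {ι α : Type*} [DecidableEq ι]
    (O F : Finset ι) (hFO : F ⊆ O)
    (p : ι → ℝ) (W : ι → Finset α) (r : ι → α → ℝ) (j : ι → α)
    (E Wt : Finset ι × Finset ι → ℝ)
    (hE : ∀ c, E c = ∑ i ∈ O \ (c.1 ∪ c.2), (1 - p i)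
        + ∑ i ∈ c.2, (1 - p i) * r i (j i)
        - ∑ i ∈ F, (1 - p i) * ∏ h ∈ W i, r i h)
    (hW : ∀ c, Wt c = ∑ i ∈ c.1, (1 - p i)
        + ∑ i ∈ c.2, (1 - p i) * (1 - r i (j i)))
    (Adm : Finset ι × Finset ι → Prop)
    (hAdm : ∀ c, Adm c ↔ c.1 ⊆ O ∧ c.2 ⊆ O ∧ Disjoint c.1 c.2 ∧ Disjoint F c.1) :
    (∀ c, Adm c →
        E c + Wt c = ∑ i ∈ O, (1 - p i) - ∑ i ∈ F, (1 - p i) * ∏ h ∈ W i, r i h)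
      ∧ ∀ c, Adm c →
        ((∀ c', Adm c' → E c ≤ E c') ↔ ∀ c', Adm c' → Wt c' ≤ Wt c) := by
  have key : ∀ c, Adm c →
      E c + Wt c = ∑ i ∈ O, (1 - p i) - ∑ i ∈ F, (1 - p i) * ∏ h ∈ W i, r i h := by
    intro c hc
    obtain ⟨hn, hu, hd, -⟩ := (hAdm c).1 hc
    have hO := Finset.sum_sdiff (f := fun i => 1 - p i) (Finset.union_subset hn hu)
    rw [Finset.sum_union hd] at hO
    have hsplit : ∑ i ∈ c.2, (1 - p i) * r i (j i) + ∑ i ∈ c.2, (1 - p i) * (1 - r i (j i))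
        = ∑ i ∈ c.2, (1 - p i) := by
      rw [← Finset.sum_add_distrib]
      exact Finset.sum_congr rfl fun i _ => by ring
    rw [hE, hW]
    linarith
  refine ⟨key, fun c hc => forall₂_congr fun c' hc' => ?_⟩
  have h := key c hc
  have h' := key c' hc'
  constructor <;> intro _ <;> linarith
end
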